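/- In the quotient G of the braid group B_3 = ⟨σ1, σ2 | σ1σ2σ1 = σ2σ1σ2⟩ by the normal closure of {σ1^4, σ2^4}, the images of the sixteen words Id, σ1, σ1^{-1}, σ1^2, σ1σ2, σ1^{-1}σ2, σ1^{-1}σ2^{-1}, σ1^2σ2, σ1^2σ2^{-1}, σ1^2σ2^2, σ1σ2^{-1}σ1σ2^{-1}, σ1σ2^2σ1σ2^{-1}, σ1σ2^{-1}σ1^2σ2^{-1}, σ1σ2^2σ1σ2^2, σ1^{-1}σ2^2σ1^{-1}σ2^2, (σ1σ2^{-1})^3 are pairwise non-conjugate, and every element of G is conjugate to one of these sixteen elements. -/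

import Mathlib

/-- The braid relator for `B₃ = ⟨σ1, σ2 | σ1σ2σ1 = σ2σ1σ2⟩`. -/
def braidRels : Set (FreeGroup (Fin 2)) :=
  {FreeGroup.of 0 * FreeGroup.of 1 * FreeGroup.of 0 *
    (FreeGroup.of 1 * FreeGroup.of 0 * FreeGroup.of 1)⁻¹}

/-- The braid group on three strands, as a presented group. -/
abbrev BraidGroup3 : Type := PresentedGroup braidRels

/-- The generator σ1 of `B₃`. -/
def sigma1 : BraidGroup3 := PresentedGroup.of 0

/-- The generator σ2 of `B₃`. -/
def sigma2 : BraidGroup3 := PresentedGroup.of 1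

/-- The quotient `G = B₃/(σ1⁴, σ2⁴)`. -/
abbrev B3ModFourthPowers : Type :=
  BraidGroup3 ⧸ Subgroup.normalClosure ({sigma1 ^ 4, sigma2 ^ 4} : Set BraidGroup3)

/-- The image of σ1 in `G`. -/
def s : B3ModFourthPowers :=
  QuotientGroup.mk' (Subgroup.normalClosure ({sigma1 ^ 4, sigma2 ^ 4} : Set BraidGroup3)) sigma1

/-- The image of σ2 in `G`. -/
def t : B3ModFourthPowers :=
  QuotientGroup.mk' (Subgroup.normalClosure ({sigma1 ^ 4, sigma2 ^ 4} : Set BraidGroup3)) sigma2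

/-- The sixteen words listed in the paper, as elements of `G = B₃/(σ1⁴, σ2⁴)`. -/
def conjReps : Fin 16 → B3ModFourthPowers :=
  ![1, s, s⁻¹, s ^ 2, s * t, s⁻¹ * t, s⁻¹ * t⁻¹, s ^ 2 * t, s ^ 2 * t⁻¹, s ^ 2 * t ^ 2,
    s * t⁻¹ * s * t⁻¹, s * t ^ 2 * s * t⁻¹, s * t⁻¹ * s ^ 2 * t⁻¹, s * t ^ 2 * s * t ^ 2,
    s⁻¹ * t ^ 2 * s⁻¹ * t ^ 2, (s * t⁻¹) ^ 3]

/-- Elements `a`, `b` with trivial fourth powers that satisfy the braid relation. -/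
structure QuarticBraidPair {H : Type*} [Group H] (a b : H) : Prop where
  braid : a * b * a = b * a * b
  left_pow : a ^ 4 = 1
  right_pow : b ^ 4 = 1

namespace QuarticBraidPair

variable {H : Type*} [Group H] {a b : H}

protected theorem symm (h : QuarticBraidPair a b) : QuarticBraidPair b a :=
  ⟨h.braid.symm, h.right_pow, h.left_pow⟩

theorem semiconjBy (h : QuarticBraidPair a b) : SemiconjBy (a * b) a b := by
  simpa [SemiconjBy, mul_assoc] using h.braid

theorem mul_mul_pow (h : QuarticBraidPair a b) (k : ℕ) : a * b * a ^ k = b ^ k * a * b := by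
  simpa [SemiconjBy, mul_assoc] using h.semiconjBy.pow_right k

theorem mul_pow_succ_mul_mul (h : QuarticBraidPair a b) (k : ℕ) :
    b * a ^ (k + 1) * b * a = a * b * a ^ 2 * b ^ k :=
  calc
    b * a ^ (k + 1) * b * a = b * a * (a ^ k * b * a) := by simp only [pow_succ', mul_assoc]
    _ = b * a * b * a * b ^ k := by rw [← h.symm.mul_mul_pow]; simp only [mul_assoc]
    _ = a * b * a ^ 2 * b ^ k := by rw [← h.braid]; simp only [pow_two, mul_assoc]

theorem mul_pow_mul_pow_three (h : QuarticBraidPair a b) (k : ℕ) :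
    b * a ^ k * b ^ 3 = a ^ 3 * b ^ k * a :=
  calc
    b * a ^ k * b ^ 3 = a ^ 4 * b * a ^ k * b ^ 3 := by rw [h.left_pow, one_mul]
    _ = a ^ 3 * (a * b * a ^ k) * b ^ 3 := by simp only [pow_succ, mul_assoc]
    _ = a ^ 3 * b ^ k * a * b ^ 4 := by
      rw [h.mul_mul_pow, pow_succ' b 3]; simp only [mul_assoc]
    _ = a ^ 3 * b ^ k * a := by rw [h.right_pow, mul_one]

theorem pow_three_mul_pow_mul (h : QuarticBraidPair a b) (k : ℕ) :
    b ^ 3 * a ^ k * b = a * b ^ k * a ^ 3 :=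
  calc
    b ^ 3 * a ^ k * b = b ^ 3 * a ^ k * b * a ^ 4 := by rw [h.left_pow, mul_one]
    _ = b ^ 3 * (a ^ k * b * a) * a ^ 3 := by rw [pow_succ' a 3]; simp only [mul_assoc]
    _ = b ^ 4 * a * b ^ k * a ^ 3 := by
      rw [← h.symm.mul_mul_pow, pow_succ b 3]; simp only [mul_assoc]
    _ = a * b ^ k * a ^ 3 := by rw [h.right_pow, one_mul]

theorem mul_pow_three_mul_sq_mul_sq_mul (h : QuarticBraidPair a b) :
    b * a ^ 3 * b ^ 2 * a ^ 2 * b = a * b * a ^ 3 * b ^ 2 * a ^ 2 :=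
  calc
    b * a ^ 3 * b ^ 2 * a ^ 2 * b = b * (a ^ 3 * b ^ 2 * a) * a * b := by
      simp only [pow_two, mul_assoc]
    _ = b ^ 2 * a ^ 2 * (b ^ 3 * a ^ 1 * b) := by
      rw [← h.mul_pow_mul_pow_three]; simp only [pow_two, pow_one, mul_assoc]
    _ = b ^ 2 * (a ^ 3 * b ^ 1 * a) * a ^ 2 := by
      rw [h.pow_three_mul_pow_mul]; simp only [pow_succ, mul_assoc, pow_zero, one_mul]
    _ = b ^ 3 * a * b * b ^ 2 * a ^ 2 := by
      rw [← h.mul_pow_mul_pow_three]; simp only [pow_succ, mul_assoc, pow_zero, one_mul]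
    _ = a * b * a ^ 3 * b ^ 2 * a ^ 2 := by rw [h.mul_mul_pow]

theorem commute_mul_sq_mul (h : QuarticBraidPair a b) : Commute (a * b ^ 2 * a) b :=
  calc
    a * b ^ 2 * a * b = a * b * (b * a * b) := by simp only [pow_two, mul_assoc]
    _ = a * b * a * (b * a) := by rw [← h.braid]; simp only [mul_assoc]
    _ = b * (a * b ^ 2 * a) := by rw [h.braid]; simp only [pow_two, mul_assoc]

theorem commute_full_twist (h : QuarticBraidPair a b) : Commute (a * b ^ 2 * a * b ^ 2) a := by
  have key : a * b ^ 2 * a * b ^ 2 = b * a ^ 2 * b * a ^ 2 :=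
    calc
      a * b ^ 2 * a * b ^ 2 = a * b * (b * a * b) * b := by simp only [pow_two, mul_assoc]
      _ = (a * b * a) * b * (a * b) := by rw [← h.braid]; simp only [mul_assoc]
      _ = b * a * (b * (b * a * b)) := by rw [h.braid]; simp only [mul_assoc]
      _ = b * a * (b * (a * b * a)) := by rw [h.braid]
      _ = b * a * (b * a * b) * a := by simp only [mul_assoc]
      _ = b * a ^ 2 * b * a ^ 2 := by rw [← h.braid]; simp only [pow_two, mul_assoc]
  rw [key]
  exact h.symm.commute_mul_sq_mul.mul_left ((Commute.refl a).pow_left 2)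

theorem commute_sq_mul_sq_mul_sq (h : QuarticBraidPair a b) :
    Commute (a ^ 2 * b ^ 2 * a ^ 2) b := by
  have key : a ^ 2 * b ^ 2 * a ^ 2 = a * b ^ 2 * a * b ^ 2 * (a * b ^ 2 * a) :=
    calc
      a ^ 2 * b ^ 2 * a ^ 2 = a * (a * b ^ 2 * a * b ^ 4) * a := by
        rw [h.right_pow, mul_one]; simp only [pow_two, mul_assoc]
      _ = a * (a * b ^ 2 * a * b ^ 2) * b ^ 2 * a := by
        simp only [pow_succ, mul_assoc, pow_zero, one_mul]
      _ = a * b ^ 2 * a * b ^ 2 * (a * b ^ 2 * a) := by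
        rw [← h.commute_full_twist.eq]; simp only [mul_assoc]
  rw [key]
  exact (h.commute_mul_sq_mul.mul_left ((Commute.refl b).pow_left 2)).mul_left
    h.commute_mul_sq_mul

theorem commute_pow_three_mul_sq_mul_pow_three (h : QuarticBraidPair a b) :
    Commute (a ^ 3 * b ^ 2 * a ^ 3) b := by
  have ha : a ^ 3 = a⁻¹ := eq_inv_of_mul_eq_one_left (by rw [← pow_succ, h.left_pow])
  have hb : b ^ 2 = (b ^ 2)⁻¹ := eq_inv_of_mul_eq_one_left (by rw [← pow_add, h.right_pow])
  have key : a ^ 3 * b ^ 2 * a ^ 3 = (a * b ^ 2 * a)⁻¹ := by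
    rw [ha, mul_inv_rev, mul_inv_rev, ← hb, mul_assoc]
  rw [key]
  exact h.commute_mul_sq_mul.inv_left

theorem commute_sq_mul_pow_three_mul_sq (h : QuarticBraidPair a b) :
    Commute (a ^ 2 * b ^ 3 * a ^ 2) b := by
  have key : a ^ 2 * b ^ 3 * a ^ 2 = a ^ 2 * b ^ 2 * a ^ 2 * (b * a ^ 2 * b * a ^ 2) * b⁻¹ := by
    rw [eq_mul_inv_iff_mul_eq]
    calc
      a ^ 2 * b ^ 3 * a ^ 2 * b = a ^ 2 * b ^ 2 * (b * a ^ 2 * b * a ^ 4) := by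
        rw [h.left_pow, mul_one, pow_succ b 2]; simp only [mul_assoc]
      _ = a ^ 2 * b ^ 2 * (b * a ^ 2 * b * a ^ 2 * a ^ 2) := by
        rw [mul_assoc (b * a ^ 2 * b), ← pow_add]
      _ = a ^ 2 * b ^ 2 * a ^ 2 * (b * a ^ 2 * b * a ^ 2) := by
        rw [((h.symm.commute_mul_sq_mul.mul_left ((Commute.refl a).pow_left 2)).pow_right 2).eq]
        simp only [mul_assoc]
  rw [key]
  exact (h.commute_sq_mul_sq_mul_sq.mul_left h.symm.commute_full_twist).mul_left
    (Commute.refl b).inv_left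

end QuarticBraidPair

/-- Representatives of the right cosets of the subgroup generated by `a`. -/
def cosetWord {M : Type*} [Monoid M] (a b : M) : Fin 24 → M :=
  ![1, b, b * a, b ^ 2, b * a ^ 2, b ^ 2 * a, b ^ 3, b * a ^ 3, b * a ^ 2 * b, b ^ 2 * a ^ 2,
    b ^ 3 * a, b * a ^ 3 * b, b * a ^ 2 * b ^ 2, b ^ 2 * a ^ 3, b ^ 2 * a ^ 2 * b,
    b ^ 3 * a ^ 2, b * a ^ 3 * b ^ 2, b * a ^ 2 * b ^ 2 * a, b ^ 2 * a ^ 3 * b,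
    b ^ 2 * a ^ 2 * b ^ 2, b ^ 3 * a ^ 3, b * a ^ 3 * b ^ 2 * a, b ^ 2 * a ^ 3 * b ^ 2,
    b * a ^ 3 * b ^ 2 * a ^ 2]

/-- The word `a ^ k * cosetWord a b i`. -/
def normalWord {M : Type*} [Monoid M] (a b : M) (p : Fin 4 × Fin 24) : M :=
  a ^ (p.1 : ℕ) * cosetWord a b p.2

theorem normalWord_zero {M : Type*} [Monoid M] (a b : M) : normalWord a b (0, 0) = 1 := by
  simp [normalWord, cosetWord]

theorem map_normalWord {M N : Type*} [Monoid M] [Monoid N] (f : M →* N) (a b : M)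
    (p : Fin 4 × Fin 24) : f (normalWord a b p) = normalWord (f a) (f b) p := by
  obtain ⟨k, i⟩ := p
  fin_cases i <;> simp [normalWord, cosetWord]

namespace QuarticBraidPair

variable {H : Type*} [Group H] {a b : H}

/-- Right multiplication by either generator permutes the right cosets of the subgroup generated
by `a`. -/
theorem cosetWord_mul (h : QuarticBraidPair a b) (i : Fin 24) :
    cosetWord a b i * a = normalWord a b
      (![1, 0, 0, 0, 0, 0, 0, 0, 1, 0, 0, 1, 0, 0, 1, 0, 0, 2, 1, 1, 0, 0, 1, 3] i,
        ![0, 2, 4, 5, 7, 9, 10, 1, 8, 13, 15, 12, 17, 3, 11, 20, 21, 14, 16, 19, 6, 23, 22, 18]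
          i) ∧
    cosetWord a b i * b = normalWord a b
      (![0, 0, 1, 0, 0, 1, 0, 0, 0, 0, 1, 0, 3, 0, 0, 1, 3, 1, 0, 0, 1, 0, 3, 1] i,
        ![1, 3, 2, 6, 8, 4, 0, 11, 12, 14, 7, 16, 5, 18, 19, 13, 10, 17, 22, 21, 20, 9, 15, 23]
          i) := by
  have extend {u v : H} (huv : u = v) (x : H) : u * x = v * x := by rw [huv]
  have r₁ := extend h.left_pow
  have r₂ := extend h.right_pow
  have r₃ := extend h.braid.symm
  have r₄ := extend (h.mul_pow_succ_mul_mul 1)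
  have r₅ := extend (h.mul_pow_succ_mul_mul 2)
  have r₆ := extend (h.mul_pow_mul_pow_three 2)
  have r₇ := extend (h.mul_pow_mul_pow_three 3)
  have r₈ := extend (h.pow_three_mul_pow_mul 2)
  have r₉ := extend (h.pow_three_mul_pow_mul 3)
  have r₁₀ := extend h.mul_pow_three_mul_sq_mul_sq_mul
  have r₁₁ := extend h.commute_sq_mul_sq_mul_sq.eq.symm
  have r₁₂ := extend h.symm.commute_sq_mul_sq_mul_sq.eq
  have r₁₃ := extend h.commute_pow_three_mul_sq_mul_pow_three.eq.symm
  have r₁₄ := extend h.symm.commute_sq_mul_pow_three_mul_sq.eq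
  simp only [pow_succ, pow_zero, one_mul, mul_assoc, Nat.reduceAdd]
    at r₁ r₂ r₃ r₄ r₅ r₆ r₇ r₈ r₉ r₁₀ r₁₁ r₁₂ r₁₃ r₁₄
  obtain ⟨x⟩ : Nonempty H := ⟨1⟩
  constructor <;> apply mul_right_cancel (b := x) <;> fin_cases i <;>
    simp [normalWord, cosetWord, pow_succ, mul_assoc, r₁, r₂, r₃, r₄, r₅, r₆, r₇, r₈, r₉, r₁₀,
      r₁₁, r₁₂, r₁₃, r₁₄]

theorem normalWord_mul_eq (h : QuarticBraidPair a b) {g : H}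
    (hg : ∀ i, ∃ q, cosetWord a b i * g = normalWord a b q) (p : Fin 4 × Fin 24) :
    ∃ q, normalWord a b p * g = normalWord a b q := by
  obtain ⟨q, hq⟩ := hg p.2
  refine ⟨(p.1 + q.1, q.2), ?_⟩
  rw [normalWord, mul_assoc, hq, normalWord, normalWord, ← mul_assoc, ← pow_add, Fin.val_add,
    pow_eq_pow_mod _ h.left_pow]

end QuarticBraidPair

theorem quarticBraidPair_s_t : QuarticBraidPair s t where
  braid := by
    have h : sigma1 * sigma2 * sigma1 = sigma2 * sigma1 * sigma2 :=
      mul_inv_eq_one.mp (PresentedGroup.one_of_mem (rels := braidRels) rfl)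
    simpa only [s, t, map_mul] using congrArg (QuotientGroup.mk'
      (Subgroup.normalClosure ({sigma1 ^ 4, sigma2 ^ 4} : Set BraidGroup3))) h
  left_pow := (QuotientGroup.eq_one_iff _).mpr (Subgroup.subset_normalClosure (by simp))
  right_pow := (QuotientGroup.eq_one_iff _).mpr (Subgroup.subset_normalClosure (by simp))

theorem exists_eq_normalWord (g : B3ModFourthPowers) : ∃ p, g = normalWord s t p := by
  have h := quarticBraidPair_s_t
  let P : Submonoid B3ModFourthPowers :=
    { carrier := {x | ∀ p, ∃ q, normalWord s t p * x = normalWord s t q}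
      one_mem' := fun p ↦ ⟨p, mul_one _⟩
      mul_mem' := fun {x y} hx hy p ↦ by
        obtain ⟨q, hq⟩ := hx p
        rw [← mul_assoc, hq]
        exact hy q }
  have hs : s ∈ P := h.normalWord_mul_eq fun i ↦ ⟨_, (h.cosetWord_mul i).1⟩
  have ht : t ∈ P := h.normalWord_mul_eq fun i ↦ ⟨_, (h.cosetWord_mul i).2⟩
  have hs' : s⁻¹ ∈ P := by
    rw [inv_eq_of_mul_eq_one_right ((pow_succ' s 3).symm.trans h.left_pow)]
    exact P.pow_mem hs 3
  have ht' : t⁻¹ ∈ P := by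
    rw [inv_eq_of_mul_eq_one_right ((pow_succ' t 3).symm.trans h.right_pow)]
    exact P.pow_mem ht 3
  suffices hg : g ∈ P by
    obtain ⟨q, hq⟩ := hg (0, 0)
    exact ⟨q, by simpa only [normalWord_zero, one_mul] using hq⟩
  obtain ⟨x, rfl⟩ := QuotientGroup.mk'_surjective _ g
  obtain ⟨w, rfl⟩ := PresentedGroup.mk_surjective _ x
  induction w using FreeGroup.induction_on with
  | C1 => simpa only [map_one] using P.one_mem
  | of i => fin_cases i; exacts [hs, ht]
  | inv_of i _ => fin_cases i; exacts [hs', ht']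
  | mul x y hx hy => simpa only [map_mul] using P.mul_mem hx hy

/-- The image of `s` in `GL₂(𝔽₅)`. -/
def matS : (Matrix (Fin 2) (Fin 2) (ZMod 5))ˣ :=
  ⟨!![1, 1; 0, 2], !![1, 2; 0, 3], by decide, by decide⟩

/-- The image of `t` in `GL₂(𝔽₅)`. -/
def matT : (Matrix (Fin 2) (Fin 2) (ZMod 5))ˣ :=
  ⟨!![1, 0; 2, 2], !![1, 0; 4, 3], by decide, by decide⟩

theorem quarticBraidPair_matS_matT : QuarticBraidPair matS matT where
  braid := by decide +kernel
  left_pow := by decide +kernel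
  right_pow := by decide +kernel

/-- The reduced Burau representation of `B₃` over `𝔽₅`, with parameter of order four. -/
def braidBurau : BraidGroup3 →* (Matrix (Fin 2) (Fin 2) (ZMod 5))ˣ :=
  PresentedGroup.toGroup (f := ![matS, matT]) <| by
    rintro _ rfl
    rw [map_mul, map_inv, mul_inv_eq_one]
    simpa using quarticBraidPair_matS_matT.braid

theorem braidBurau_sigma1 : braidBurau sigma1 = matS :=
  PresentedGroup.toGroup.of _

theorem braidBurau_sigma2 : braidBurau sigma2 = matT :=
  PresentedGroup.toGroup.of _

/-- The matrix representation of `B₃/(σ1⁴, σ2⁴)` induced by `braidBurau`. -/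
def burau : B3ModFourthPowers →* Matrix (Fin 2) (Fin 2) (ZMod 5) :=
  (Units.coeHom _).comp <| QuotientGroup.lift _ braidBurau <|
    Subgroup.normalClosure_le_normal (N := braidBurau.ker) <| by
      rintro _ (rfl | rfl)
      · simpa [braidBurau_sigma1] using quarticBraidPair_matS_matT.left_pow
      · simpa [braidBurau_sigma2] using quarticBraidPair_matS_matT.right_pow

theorem burau_s : burau s = matS :=
  congrArg Units.val braidBurau_sigma1

theorem burau_t : burau t = matT :=
  congrArg Units.val braidBurau_sigma2

theorem burau_normalWord (p : Fin 4 × Fin 24) :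
    burau (normalWord s t p) = normalWord matS.val matT.val p := by
  rw [map_normalWord, burau_s, burau_t]

theorem burau_injective : Function.Injective burau := by
  intro x y hxy
  have key : ∀ p, normalWord matS.val matT.val p = 1 → p = (0, 0) := by decide +kernel
  obtain ⟨p, hp⟩ := exists_eq_normalWord (x * y⁻¹)
  have hp₁ : burau (x * y⁻¹) = 1 := by
    rw [map_mul, hxy, ← map_mul, mul_inv_cancel, map_one]
  rw [hp, burau_normalWord] at hp₁
  rw [← mul_inv_eq_one, hp, key p hp₁, normalWord_zero]

/-- The words of `conjReps`, with inverses replaced by third powers. -/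
def conjWord {M : Type*} [Monoid M] (a b : M) : Fin 16 → M :=
  ![1, a, a ^ 3, a ^ 2, a * b, a ^ 3 * b, a ^ 3 * b ^ 3, a ^ 2 * b, a ^ 2 * b ^ 3, a ^ 2 * b ^ 2,
    a * b ^ 3 * a * b ^ 3, a * b ^ 2 * a * b ^ 3, a * b ^ 3 * a ^ 2 * b ^ 3,
    a * b ^ 2 * a * b ^ 2, a ^ 3 * b ^ 2 * a ^ 3 * b ^ 2, (a * b ^ 3) ^ 3]

theorem burau_conjReps (i : Fin 16) :
    burau (conjReps i) = conjWord matS.val matT.val i := by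
  have hs := inv_eq_of_mul_eq_one_right ((pow_succ' s 3).symm.trans quarticBraidPair_s_t.left_pow)
  have ht := inv_eq_of_mul_eq_one_right ((pow_succ' t 3).symm.trans quarticBraidPair_s_t.right_pow)
  fin_cases i <;> simp [conjReps, conjWord, hs, ht, burau_s, burau_t]

theorem trace_det_conjWord_injective :
    Function.Injective fun i ↦ ((conjWord matS.val matT.val i).trace,
      (conjWord matS.val matT.val i).det) := by
  decide +kernel

theorem exists_normalWord_mul_conjWord (p : Fin 4 × Fin 24) :
    ∃ i q, normalWord matS.val matT.val q * conjWord matS.val matT.val i =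
      normalWord matS.val matT.val p * normalWord matS.val matT.val q := by
  have key : ∀ p, ∃ i,
      (conjWord matS.val matT.val i).trace = (normalWord matS.val matT.val p).trace ∧
      (conjWord matS.val matT.val i).det = (normalWord matS.val matT.val p).det ∧
      ∃ q, normalWord matS.val matT.val q * conjWord matS.val matT.val i =
        normalWord matS.val matT.val p * normalWord matS.val matT.val q := by
    decide +kernel
  obtain ⟨i, -, -, h⟩ := key p
  exact ⟨i, h⟩

/-- The sixteen listed elements of `G = B₃/(σ1⁴, σ2⁴)` are pairwise non-conjugate, and every
element of `G` is conjugate to one of them. -/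
theorem B3_mod_fourth_powers_conjClasses_reps :
    (∀ i j : Fin 16, i ≠ j → ¬ IsConj (conjReps i) (conjReps j)) ∧
    (∀ g : B3ModFourthPowers, ∃ i : Fin 16, IsConj (conjReps i) g) := by
  refine ⟨fun i j hij h ↦ hij (trace_det_conjWord_injective ?_), fun g ↦ ?_⟩
  · obtain ⟨c, hc⟩ := isConj_iff.mp h
    have hc' : burau c⁻¹ * burau c = 1 := by rw [← map_mul, inv_mul_cancel, map_one]
    simp only [← burau_conjReps, ← hc, map_mul, Prod.mk.injEq]
    constructor
    · rw [Matrix.trace_mul_comm, ← mul_assoc, hc', one_mul]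
    · rw [Matrix.det_mul_comm, ← mul_assoc, hc', one_mul]
  · obtain ⟨p, rfl⟩ := exists_eq_normalWord g
    obtain ⟨i, q, h⟩ := exists_normalWord_mul_conjWord p
    refine ⟨i, isConj_iff.mpr ⟨normalWord s t q, mul_inv_eq_of_eq_mul (burau_injective ?_)⟩⟩
    rw [map_mul, map_mul, burau_normalWord, burau_normalWord, burau_conjReps, h]
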